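/- Let x be a vector in the James Tree space JT whose support is contained in a single branch of the dyadic tree T. If x is separated, then ‖x‖_{JT} = ‖x‖₂, and consequently x is an extreme point of the ball of radius ‖x‖_{JT}. -/

import Mathlib

/-! Common framework for the James Tree space `JT`.

The dyadic tree is modelled as `List Bool`, ordered by `List.IsPrefix` (`<+:`). -/

abbrev DyadicNode := List Bool

namespace JTSpace

/-- A segment of the dyadic tree: a linearly ordered, order-convex subset. -/
def IsSegment (S : Set DyadicNode) : Prop :=
  (∀ a ∈ S, ∀ b ∈ S, a <+: b ∨ b <+: a) ∧
  (∀ a ∈ S, ∀ b ∈ S, ∀ c : DyadicNode, a <+: c → c <+: b → c ∈ S)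

/-- A partition: a family of pairwise disjoint segments. -/
def IsPartition (P : Set (Set DyadicNode)) : Prop :=
  (∀ S ∈ P, IsSegment S) ∧ P.PairwiseDisjoint id

/-- The sum of `x` along a set of nodes. -/
noncomputable def segSum (x : DyadicNode → ℝ) (S : Set DyadicNode) : ℝ :=
  ∑' a : S, x a

/-- The square of the value `‖x‖_P` of `x` on the partition `P`. -/
noncomputable def pNormSq (x : DyadicNode → ℝ) (P : Set (Set DyadicNode)) : ℝ :=
  ∑' S : P, (segSum x S) ^ 2

/-- The set of all values `‖x‖_P²` over partitions `P`. -/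
def normSqSet (x : DyadicNode → ℝ) : Set ℝ :=
  {r | ∃ P, IsPartition P ∧ r = pNormSq x P}

/-- The square of the `JT` norm. -/
noncomputable def JTnormSq (x : DyadicNode → ℝ) : ℝ := sSup (normSqSet x)

/-- The `JT` norm of `x`. -/
noncomputable def JTnorm (x : DyadicNode → ℝ) : ℝ := Real.sqrt (JTnormSq x)

/-- The `ℓ₂` norm of `x`. -/
noncomputable def l2norm (x : DyadicNode → ℝ) : ℝ := Real.sqrt (∑' a, (x a) ^ 2)

def HasBddNorm (x : DyadicNode → ℝ) : Prop := BddAbove (normSqSet x)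

/-- `x` belongs to the James Tree space: its norm is finite and it is approximable in the
`JT` norm by finitely supported functions (`JT` is the completion of `c₀₀(T)`). -/
def MemJT (x : DyadicNode → ℝ) : Prop :=
  HasBddNorm x ∧
  ∀ ε > (0 : ℝ), ∃ y : DyadicNode → ℝ, (Function.support y).Finite ∧
    HasBddNorm (x - y) ∧ JTnorm (x - y) ≤ ε

/-- An `x`-norming partition. -/
def IsNormingPartition (x : DyadicNode → ℝ) (P : Set (Set DyadicNode)) : Prop :=
  IsPartition P ∧ pNormSq x P = JTnormSq x

/-- A complete subtree of the dyadic tree. -/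
def IsCompleteSubtree (K : Set DyadicNode) : Prop :=
  ∀ a ∈ K, ∀ b ∈ K, ∀ c : DyadicNode, a <+: c → c <+: b → c ∈ K

/-- The range of `x`: the smallest complete subtree containing the support of `x`. -/
def ran (x : DyadicNode → ℝ) : Set DyadicNode :=
  ⋂₀ {K | IsCompleteSubtree K ∧ Function.support x ⊆ K}

/-- `x` is separated: every two distinct nodes of `ran x` are separated by some
`x`-norming partition. -/
def Separated (x : DyadicNode → ℝ) : Prop :=
  ∀ a ∈ ran x, ∀ b ∈ ran x, a ≠ b →
    ∃ P, IsNormingPartition x P ∧ ∃ S ∈ P, ∃ S' ∈ P, S ≠ S' ∧ a ∈ S ∧ b ∈ S'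

/-- `x` is an extreme point of the ball of radius `‖x‖_{JT}`. -/
def IsExtremePoint (x : DyadicNode → ℝ) : Prop :=
  x ≠ 0 ∧
  ∀ y z : DyadicNode → ℝ, MemJT y → MemJT z →
    ∀ l : ℝ, 0 < l → l < 1 → x = l • y + (1 - l) • z →
      JTnorm y = JTnorm x → JTnorm z = JTnorm x → y = x ∧ z = x

/-- A branch: a maximal segment. -/
def IsBranch (b : Set DyadicNode) : Prop :=
  IsSegment b ∧ ∀ S : Set DyadicNode, IsSegment S → b ⊆ S → S = b

/-- The wedge rooted at `a`. -/
def wedge (a : DyadicNode) : Set DyadicNode := {b | a <+: b}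

/-- The two children of a node. -/
def children (u : DyadicNode) : Set DyadicNode := {u ++ [false], u ++ [true]}

/-- The maximal segment sum starting at `a`:
`S_a(x) = sup { S_s(x) : s a segment with min s = a }`. -/
noncomputable def maxSum (x : DyadicNode → ℝ) (a : DyadicNode) : ℝ :=
  sSup {r | ∃ s : Set DyadicNode, IsSegment s ∧ a ∈ s ∧ (∀ b ∈ s, a <+: b) ∧ r = segSum x s}

/-- The children of `u` within the subtree spanned by the support of `x`. -/
def supportedChildren (x : DyadicNode → ℝ) (u : DyadicNode) : Set DyadicNode :=
  {c ∈ children u | ∃ b ∈ Function.support x, c <+: b}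

/-- A greedy partition for a positive vector `x`: a partition whose segments cover the
support of `x` and such that every segment, at every support node `u` which has a strict
descendant in the support, continues through a child of `u` (within the subtree spanned by
the support) maximizing the maximal segment sum, down to the next element of the support;
at support nodes with no strict descendant in the support, the segment's support ends. -/
def IsGreedyPartition (x : DyadicNode → ℝ) (P : Set (Set DyadicNode)) : Prop :=
  IsPartition P ∧ Function.support x ⊆ ⋃₀ P ∧
  ∀ s ∈ P, ∀ u ∈ s ∩ Function.support x,
    ((∃ w ∈ Function.support x, u <+: w ∧ u ≠ w) →
      ∃ v ∈ s ∩ Function.support x, u <+: v ∧ u ≠ v ∧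
        (∀ w ∈ s ∩ Function.support x, u <+: w → u ≠ w → v <+: w) ∧
        ∃ c ∈ supportedChildren x u, c <+: v ∧
          ∀ k ∈ supportedChildren x u, maxSum x k ≤ maxSum x c) ∧
    ((¬ ∃ w ∈ Function.support x, u <+: w ∧ u ≠ w) →
      ∀ w ∈ s ∩ Function.support x, w <+: u)


/-- Value `c` is achieved by a finite family of disjoint segments inside `U`. -/
def Ach (x : DyadicNode → ℝ) (c : ℝ) (U : Set DyadicNode) : Prop :=
  ∃ G : Finset (Set DyadicNode), (∀ S ∈ G, IsSegment S ∧ S ⊆ U) ∧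
    (G : Set (Set DyadicNode)).PairwiseDisjoint id ∧ c ≤ ∑ S ∈ G, segSum x S ^ 2

lemma segSum_empty (x : DyadicNode → ℝ) : segSum x ∅ = 0 := by
  simp [segSum]

lemma Ach.le {x : DyadicNode → ℝ} (hx : HasBddNorm x) {c : ℝ} {U : Set DyadicNode}
    (h : Ach x c U) : c ≤ JTnormSq x := by
  obtain ⟨G, h1, h2, h3⟩ := h
  refine h3.trans (le_csSup hx ⟨(G : Set (Set DyadicNode)), ⟨fun S hS => (h1 S hS).1, h2⟩, ?_⟩)
  unfold pNormSq
  exact (Finset.tsum_subtype G (fun S => segSum x S ^ 2)).symm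

lemma Ach.union {x : DyadicNode → ℝ} {c d : ℝ} {U V : Set DyadicNode}
    (h : Ach x c U) (h' : Ach x d V) (hUV : Disjoint U V) : Ach x (c + d) (U ∪ V) := by
  classical
  obtain ⟨G, h1, h2, h3⟩ := h
  obtain ⟨H, k1, k2, k3⟩ := h'
  refine ⟨G ∪ H, ?_, ?_, ?_⟩
  · intro S hS
    rcases Finset.mem_union.1 hS with hS | hS
    · exact ⟨(h1 S hS).1, (h1 S hS).2.trans Set.subset_union_left⟩
    · exact ⟨(k1 S hS).1, (k1 S hS).2.trans Set.subset_union_right⟩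
  · intro S hS T hT hST
    simp only [Finset.coe_union, Set.mem_union, Finset.mem_coe] at hS hT
    rcases hS with hS | hS <;> rcases hT with hT | hT
    · exact h2 hS hT hST
    · exact hUV.mono (h1 S hS).2 (k1 T hT).2
    · exact (hUV.mono (h1 T hT).2 (k1 S hS).2).symm
    · exact k2 hS hT hST
  · have : ∑ S ∈ G ∩ H, segSum x S ^ 2 = 0 := by
      apply Finset.sum_eq_zero
      intro S hS
      have hS' := Finset.mem_inter.1 hS
      have : S = ∅ := by
        have := hUV (h1 S hS'.1).2 (k1 S hS'.2).2
        simpa using this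
      rw [this, segSum_empty]; simp
    have h4 := Finset.sum_union_inter (s₁ := G) (s₂ := H) (f := fun S => segSum x S ^ 2)
    linarith

lemma Ach.single {x : DyadicNode → ℝ} {S : Set DyadicNode} (hS : IsSegment S) :
    Ach x (segSum x S ^ 2) S :=
  ⟨{S}, by simp [hS], by simp, by simp⟩

lemma Ach.mono {x : DyadicNode → ℝ} {c : ℝ} {U V : Set DyadicNode}
    (h : Ach x c U) (hUV : U ⊆ V) : Ach x c V := by
  obtain ⟨G, h1, h2, h3⟩ := h
  exact ⟨G, fun S hS => ⟨(h1 S hS).1, (h1 S hS).2.trans hUV⟩, h2, h3⟩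

lemma isSegment_singleton (v : DyadicNode) : IsSegment {v} := by
  constructor
  · rintro a rfl b rfl; exact Or.inl (List.prefix_refl _)
  · rintro a rfl b rfl c h1 h2
    exact (h2.eq_of_length (le_antisymm h2.length_le h1.length_le))

lemma segSum_singleton (x : DyadicNode → ℝ) (v : DyadicNode) : segSum x {v} = x v := by
  simp [segSum]

lemma Ach.points (x : DyadicNode → ℝ) (K : Finset DyadicNode) :
    Ach x (∑ v ∈ K, x v ^ 2) (K : Set DyadicNode) := by
  classical
  induction K using Finset.induction_on with
  | empty => exact ⟨∅, by simp, by simp, by simp⟩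
  | insert v K hv ih =>
    rw [Finset.sum_insert hv]
    have h := (Ach.single (x := x) (isSegment_singleton v)).union ih (by simpa using hv)
    rw [segSum_singleton] at h
    exact h.mono (by intro w; simp)

lemma sum_sq_bound {x : DyadicNode → ℝ} (hx : HasBddNorm x) :
    Summable (fun v => x v ^ 2) ∧ ∑' v, x v ^ 2 ≤ JTnormSq x := by
  have h : ∀ K : Finset DyadicNode, ∑ v ∈ K, x v ^ 2 ≤ JTnormSq x :=
    fun K => (Ach.points x K).le hx
  have hs : Summable (fun v => x v ^ 2) :=
    summable_of_sum_le (fun v => sq_nonneg _) h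
  exact ⟨hs, hs.tsum_le_of_sum_le h⟩

lemma JTnormSq_nonneg (x : DyadicNode → ℝ) : 0 ≤ JTnormSq x := by
  apply Real.sSup_nonneg
  rintro r ⟨P, -, rfl⟩
  exact tsum_nonneg fun _ => sq_nonneg _

/-- A finite disjoint family contains a point at most once. -/
lemma sum_ite_mem_le (G : Finset (Set DyadicNode))
    (hG : (G : Set (Set DyadicNode)).PairwiseDisjoint id) (v : DyadicNode) (c : ℝ) (hc : 0 ≤ c) :
    (open Classical in ∑ T ∈ G, if v ∈ T then c else 0) ≤ c := by
  classical
  rw [← Finset.sum_filter, Finset.sum_const, nsmul_eq_mul]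
  have : (G.filter (fun T => v ∈ T)).card ≤ 1 := by
    rw [Finset.card_le_one]
    intro S hS T hT
    simp only [Finset.mem_filter] at hS hT
    by_contra hne
    exact Set.disjoint_left.1 (hG hS.1 hT.1 hne) hS.2 hT.2
  have h2 : ((G.filter (fun T => v ∈ T)).card : ℝ) ≤ 1 := by exact_mod_cast this
  nlinarith

/-- An infinite chain of nodes, one at each level. -/
structure IsPath (β : ℕ → DyadicNode) : Prop where
  len : ∀ n, (β n).length = n
  mono : ∀ m n, m ≤ n → β m <+: β n

lemma IsPath.inj {β : ℕ → DyadicNode} (h : IsPath β) : Function.Injective β := by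
  intro m n hmn
  rw [← h.len m, ← h.len n, hmn]

lemma IsPath.eq_of_prefix {β : ℕ → DyadicNode} (h : IsPath β) {c : DyadicNode} {n : ℕ}
    (hc : c <+: β n) : c = β c.length ∧ c.length ≤ n := by
  have hl : c.length ≤ n := by simpa [h.len] using hc.length_le
  refine ⟨?_, hl⟩
  have h2 : c <+: β c.length :=
    List.prefix_of_prefix_length_le hc (h.mono _ _ hl) (by rw [h.len])
  exact h2.eq_of_length (by rw [h.len])

lemma IsPath.le_of_prefix {β : ℕ → DyadicNode} (h : IsPath β) {m n : ℕ}
    (hc : β m <+: β n) : m ≤ n := by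
  simpa [h.len] using hc.length_le

lemma exists_path (b : Set DyadicNode) (hb : ∀ a ∈ b, ∀ c ∈ b, a <+: c ∨ c <+: a) :
    ∃ β : ℕ → DyadicNode, IsPath β ∧ b ⊆ Set.range β := by
  classical
  let β : ℕ → DyadicNode := fun n => Nat.rec []
    (fun _ p => p ++ [decide (∃ c ∈ b, (p ++ [true]) <+: c)]) n
  have hs : ∀ n, β (n + 1) = β n ++ [decide (∃ c ∈ b, (β n ++ [true]) <+: c)] := fun n => rfl
  have hlen : ∀ n, (β n).length = n := by
    intro n
    induction n with
    | zero => rfl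
    | succ n ih => rw [hs]; simp [ih]
  have hmono : ∀ m n, m ≤ n → β m <+: β n := by
    intro m n hmn
    induction n, hmn using Nat.le_induction with
    | base => exact List.prefix_refl _
    | succ n _ ih => rw [hs]; exact ih.trans (List.prefix_append _ _)
  have key : ∀ n, ∀ c ∈ b, n ≤ c.length → β n <+: c := by
    intro n
    induction n with
    | zero => intro c _ _; exact List.nil_prefix
    | succ n ih =>
      intro c hc hn
      obtain ⟨r, hr⟩ := ih c hc (by omega)
      cases r with
      | nil =>
        have := congrArg List.length hr
        simp [hlen] at this; omega
      | cons v r =>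
        have hv : (β n ++ [v]) <+: c := ⟨r, by simpa using hr⟩
        rw [hs]
        by_cases hd : ∃ c ∈ b, (β n ++ [true]) <+: c
        · rw [decide_eq_true hd]
          obtain ⟨c', hc', hp⟩ := hd
          have : (β n ++ [v]) = (β n ++ [true]) := by
            rcases hb c hc c' hc' with h | h
            · exact (List.prefix_of_prefix_length_le (hv.trans h) hp (by simp)).eq_of_length
                (by simp)
            · exact (List.prefix_of_prefix_length_le hv (hp.trans h) (by simp)).eq_of_length
                (by simp)
          rwa [← this]
        · rw [decide_eq_false hd]
          cases v with
          | false => exact hv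
          | true => exact absurd ⟨c, hc, hv⟩ hd
  refine ⟨β, ⟨hlen, hmono⟩, fun c hc => ⟨c.length, ?_⟩⟩
  exact (key _ c hc le_rfl).eq_of_length (by rw [hlen])

lemma IsPath.segment {β : ℕ → DyadicNode} (h : IsPath β) (s t : ℕ) :
    IsSegment (β '' (Set.Ico s t)) := by
  constructor
  · rintro _ ⟨i, hi, rfl⟩ _ ⟨j, hj, rfl⟩
    rcases le_total i j with h1 | h1
    · exact Or.inl (h.mono _ _ h1)
    · exact Or.inr (h.mono _ _ h1)
  · rintro _ ⟨i, hi, rfl⟩ _ ⟨j, hj, rfl⟩ c h1 h2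
    obtain ⟨h3, h4⟩ := h.eq_of_prefix h2
    rw [h3] at h1
    have := h.le_of_prefix h1
    exact ⟨c.length, ⟨hi.1.trans this, lt_of_le_of_lt h4 hj.2⟩, h3.symm⟩

lemma IsPath.segSum_Ico {β : ℕ → DyadicNode} (h : IsPath β) (x : DyadicNode → ℝ) (s t : ℕ) :
    segSum x (β '' (Set.Ico s t)) = ∑ k ∈ Finset.Ico s t, x (β k) := by
  classical
  have : β '' (Set.Ico s t) = ((Finset.Ico s t).image β : Finset DyadicNode) := by simp
  rw [this]
  unfold segSum
  rw [← Finset.sum_image (f := x) (fun a _ b _ hab => h.inj hab)]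
  exact Finset.tsum_subtype _ x

lemma IsPath.segSum_tendsto {β : ℕ → DyadicNode} (h : IsPath β) {x : DyadicNode → ℝ}
    (hsupp : Function.support x ⊆ Set.range β) {T : Set DyadicNode}
    (hT : Summable (fun v : T => x v)) :
    open Classical in
    Filter.Tendsto (fun M => ∑ k ∈ (Finset.range M).filter (fun k => β k ∈ T), x (β k))
      Filter.atTop (nhds (segSum x T)) := by
  classical
  have h1 : HasSum (T.indicator x) (segSum x T) :=
    (hasSum_subtype_iff_indicator (f := x) (s := T)).1 hT.hasSum
  have h2 : HasSum (T.indicator x ∘ β) (segSum x T) := by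
    refine (h.inj.hasSum_iff ?_).2 h1
    intro v hv
    by_contra hne
    have : x v ≠ 0 := by
      intro h0; apply hne; simp [Set.indicator, h0]
    exact hv (hsupp this)
  refine h2.tendsto_sum_nat.congr fun M => ?_
  rw [Finset.sum_filter]
  apply Finset.sum_congr rfl
  intro k _
  simp [Set.indicator]

/-- If a set meets the path only below level `n`, its sum is finite. -/
lemma IsPath.segSum_finite {β : ℕ → DyadicNode} (h : IsPath β) {x : DyadicNode → ℝ}
    (hsupp : Function.support x ⊆ Set.range β) {T : Set DyadicNode} {n : ℕ}
    (hT : ∀ k, β k ∈ T → k < n) :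
    open Classical in
    segSum x T = ∑ k ∈ (Finset.range n).filter (fun k => β k ∈ T), x (β k) := by
  classical
  unfold segSum
  rw [tsum_subtype T x, ← Finset.sum_image (f := x) (g := β) (fun a _ b _ hab => h.inj hab)]
  rw [tsum_eq_sum (s := ((Finset.range n).filter (fun k => β k ∈ T)).image β)]
  · apply Finset.sum_congr rfl
    intro v hv
    simp only [Finset.mem_image, Finset.mem_filter] at hv
    obtain ⟨k, hk, rfl⟩ := hv
    simp [hk.2]
  · intro v hv
    by_contra hne
    have hvT : v ∈ T := by
      by_contra hv'; exact hne (by simp [hv'])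
    have : x v ≠ 0 := by
      intro h0; apply hne; simp [Set.indicator, h0]
    obtain ⟨k, rfl⟩ := hsupp this
    apply hv
    simp only [Finset.mem_image, Finset.mem_filter, Finset.mem_range]
    exact ⟨k, ⟨hT k hvT, hvT⟩, rfl⟩

/-- Interval estimates give estimates for segments. -/
lemma IsPath.filter_bound {β : ℕ → DyadicNode} (h : IsPath β) {x : DyadicNode → ℝ} {M : ℕ}
    (hE : ∀ s t, s ≤ t → t ≤ M →
      (∑ k ∈ Finset.Ico s t, x (β k)) ^ 2 ≤ ∑ k ∈ Finset.Ico s t, x (β k) ^ 2)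
    {T : Set DyadicNode} (hT : IsSegment T) :
    open Classical in
    (∑ k ∈ (Finset.range M).filter (fun k => β k ∈ T), x (β k)) ^ 2 ≤
      ∑ k ∈ (Finset.range M).filter (fun k => β k ∈ T), x (β k) ^ 2 := by
  classical
  set A := (Finset.range M).filter (fun k => β k ∈ T) with hA
  have hmem : ∀ k, k ∈ A ↔ k < M ∧ β k ∈ T := by
    intro k; rw [hA, Finset.mem_filter, Finset.mem_range]
  rcases A.eq_empty_or_nonempty with he | hne
  · rw [he]; simp
  · have : A = Finset.Ico (A.min' hne) (A.max' hne + 1) := by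
      ext k
      rw [Finset.mem_Ico]
      constructor
      · intro hk
        exact ⟨A.min'_le k hk, Nat.lt_succ_of_le (A.le_max' k hk)⟩
      · rintro ⟨h1, h2⟩
        have m1 := A.min'_mem hne
        have m2 := A.max'_mem hne
        rw [hmem] at m1 m2 ⊢
        refine ⟨by omega, hT.2 _ m1.2 _ m2.2 _ (h.mono _ _ h1) (h.mono _ _ (by omega))⟩
    have m2 := A.max'_mem hne
    have m3 := A.min'_le _ m2
    have m2' : A.max' hne < M := ((hmem _).1 m2).1
    have := hE (A.min' hne) (A.max' hne + 1) (by omega) (by omega)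
    rwa [← ‹A = Finset.Ico _ _›] at this

lemma IsPath.family_bound {β : ℕ → DyadicNode} (G : Finset (Set DyadicNode))
    (hG : (G : Set (Set DyadicNode)).PairwiseDisjoint id) (x : DyadicNode → ℝ) (M : ℕ) :
    open Classical in
    ∑ T ∈ G, ∑ k ∈ (Finset.range M).filter (fun k => β k ∈ T), x (β k) ^ 2 ≤
      ∑ k ∈ Finset.range M, x (β k) ^ 2 := by
  classical
  simp_rw [Finset.sum_filter]
  rw [Finset.sum_comm]
  apply Finset.sum_le_sum
  intro k _
  exact sum_ite_mem_le G hG (β k) _ (sq_nonneg _)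

lemma mem_ran_of_between {x : DyadicNode → ℝ} {u v w : DyadicNode} (hu : x u ≠ 0) (hw : x w ≠ 0)
    (h1 : u <+: v) (h2 : v <+: w) : v ∈ ran x := by
  intro K hK
  exact hK.1 u (hK.2 hu) w (hK.2 hw) v h1 h2

/-- The comparison lemma: a norming partition which breaks at level `n`. -/
lemma IsPath.compare {β : ℕ → DyadicNode} (h : IsPath β) {x : DyadicNode → ℝ}
    (hsupp : Function.support x ⊆ Set.range β) {n : ℕ}
    (hE : ∀ s t, s ≤ t → t ≤ n →
      (∑ k ∈ Finset.Ico s t, x (β k)) ^ 2 ≤ ∑ k ∈ Finset.Ico s t, x (β k) ^ 2)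
    {P : Set (Set DyadicNode)} (hP : IsNormingPartition x P) {S : Set DyadicNode} (hS : S ∈ P)
    (hnS : β n ∈ S) (hlow : ∀ T ∈ P, ∀ i < n, β i ∈ T → ∀ k, β k ∈ T → k < n)
    (R : ℝ) (hR : ∀ c, ∀ F : Finset (Set DyadicNode), (F : Set (Set DyadicNode)) ⊆ P →
      (∀ T ∈ F, T ≠ S ∧ ∀ i ≤ n, β i ∉ T) → c ≤ ∑ T ∈ F, segSum x T ^ 2 → R + c ≤ JTnormSq x) :
    R ≤ ∑ k ∈ Finset.range n, x (β k) ^ 2 + segSum x S ^ 2 := by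
  classical
  have main : ∀ G : Finset (Set DyadicNode), (G : Set (Set DyadicNode)) ⊆ P →
      ∑ T ∈ G, segSum x T ^ 2 ≤
        ∑ k ∈ Finset.range n, x (β k) ^ 2 + segSum x S ^ 2 + (JTnormSq x - R) := by
    intro G hGP
    have hGd : (G : Set (Set DyadicNode)).PairwiseDisjoint id := hP.1.2.subset hGP
    have e1 := hR _ (G.filter (fun T => T ≠ S ∧ ∀ i ≤ n, β i ∉ T))
      (fun T hT => hGP (Finset.mem_filter.1 hT).1) (fun T hT => (Finset.mem_filter.1 hT).2) le_rfl
    have e2 := IsPath.family_bound (β := β) G hGd x n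
    have e3 : ∑ T ∈ G, (if T = S then segSum x S ^ 2 else 0) ≤ segSum x S ^ 2 := by
      rw [Finset.sum_ite_eq']
      split_ifs
      · exact le_rfl
      · exact sq_nonneg _
    have e4 : ∑ T ∈ G, segSum x T ^ 2 ≤
        ∑ T ∈ G, ((∑ k ∈ (Finset.range n).filter (fun k => β k ∈ T), x (β k) ^ 2)
          + (if T = S then segSum x S ^ 2 else 0)
          + (if T ≠ S ∧ ∀ i ≤ n, β i ∉ T then segSum x T ^ 2 else 0)) := by
      apply Finset.sum_le_sum
      intro T hT
      have n1 : 0 ≤ ∑ k ∈ (Finset.range n).filter (fun k => β k ∈ T), x (β k) ^ 2 :=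
        Finset.sum_nonneg fun _ _ => sq_nonneg _
      by_cases hTS : T = S
      · subst hTS
        simp [n1]
      · by_cases hi : ∀ i ≤ n, β i ∉ T
        · rw [if_neg hTS, if_pos ⟨hTS, hi⟩]; linarith
        · rw [if_neg hTS, if_neg (fun hh => hi hh.2)]
          push Not at hi
          obtain ⟨i, hin, hiT⟩ := hi
          have hin' : i < n := by
            rcases hin.lt_or_eq with hh | hh
            · exact hh
            · subst hh
              exact absurd hnS (Set.disjoint_left.1 (hP.1.2 (hGP hT) hS hTS) hiT)
          have := h.filter_bound hE (hP.1.1 T (hGP hT))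
          rw [h.segSum_finite hsupp (hlow T (hGP hT) i hin' hiT)]
          linarith
    rw [Finset.sum_add_distrib, Finset.sum_add_distrib] at e4
    rw [Finset.sum_filter] at e1
    linarith
  have hN : JTnormSq x ≤
        ∑ k ∈ Finset.range n, x (β k) ^ 2 + segSum x S ^ 2 + (JTnormSq x - R) := by
    rw [← hP.2] at main ⊢
    have h0 := main ∅ (by simp)
    simp only [Finset.sum_empty] at h0
    refine tsum_le_of_sum_le' h0 ?_
    intro G
    have := main (G.map (Function.Embedding.subtype _)) (by intro T; simp; tauto)
    simpa using this
  linarith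

lemma alg_key (A a F D : ℝ) (h1 : A ^ 2 ≤ D) (h2 : (A + F) ^ 2 ≤ D + F ^ 2)
    (h3 : (A + a) ^ 2 + (F - a) ^ 2 ≤ D + F ^ 2) : (A + a) ^ 2 ≤ D + a ^ 2 := by
  by_contra hc
  push Not at hc
  have e1 : 0 < A * a := by nlinarith
  have e2 : 0 < a * (F - a) := by nlinarith
  have e3 : A * (F - a) < 0 := by nlinarith
  have e4 : 0 < (A * a) * (a * (F - a)) := mul_pos e1 e2
  nlinarith [sq_nonneg a]

lemma Ach.range {β : ℕ → DyadicNode} (h : IsPath β) (x : DyadicNode → ℝ) (s : ℕ) :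
    Ach x (∑ k ∈ Finset.range s, x (β k) ^ 2) (β '' Set.Iio s) := by
  classical
  have := Ach.points x ((Finset.range s).image β)
  rw [Finset.sum_image (fun a _ b _ hab => h.inj hab)] at this
  exact this.mono (by intro v; simp)

lemma IsPath.step {β : ℕ → DyadicNode} (h : IsPath β) {x : DyadicNode → ℝ} (hx : HasBddNorm x)
    (hsupp : Function.support x ⊆ Set.range β) (hsep : Separated x) {n : ℕ}
    (hE : ∀ s t, s ≤ t → t ≤ n →
      (∑ k ∈ Finset.Ico s t, x (β k)) ^ 2 ≤ ∑ k ∈ Finset.Ico s t, x (β k) ^ 2)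
    {s : ℕ} (hs : s ≤ n) :
    (∑ k ∈ Finset.Ico s n, x (β k) + x (β n)) ^ 2 ≤
      ∑ k ∈ Finset.Ico s n, x (β k) ^ 2 + x (β n) ^ 2 := by
  classical
  by_cases hn0 : x (β n) = 0
  · rw [hn0]; simpa using hE s n hs le_rfl
  by_cases hall : ∀ i < n, x (β i) = 0
  · rw [Finset.sum_eq_zero (s := Finset.Ico s n) (f := fun k => x (β k))
      (fun k hk => hall k (Finset.mem_Ico.1 hk).2)]
    have : 0 ≤ ∑ k ∈ Finset.Ico s n, x (β k) ^ 2 := Finset.sum_nonneg fun _ _ => sq_nonneg _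
    simpa using this
  push Not at hall
  obtain ⟨i, hin, hi⟩ := hall
  have r1 : β (n - 1) ∈ ran x :=
    mem_ran_of_between hi hn0 (h.mono _ _ (by omega)) (h.mono _ _ (by omega))
  have r2 : β n ∈ ran x :=
    mem_ran_of_between hi hn0 (h.mono _ _ (by omega)) (h.mono _ _ (by omega))
  have hne : β (n - 1) ≠ β n := fun hh => by
    have := h.inj hh
    omega
  obtain ⟨P, hP, S', hS', S, hS, hSS, hm, hnS⟩ := hsep _ r1 _ r2 hne
  have hlow : ∀ T ∈ P, ∀ i < n, β i ∈ T → ∀ k, β k ∈ T → k < n := by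
    intro T hT i hi hiT k hkT
    by_contra hk
    push Not at hk
    have t1 : β (n - 1) ∈ T := (hP.1.1 T hT).2 _ hiT _ hkT _ (h.mono _ _ (by omega))
      (h.mono _ _ (by omega))
    have t2 : β n ∈ T := (hP.1.1 T hT).2 _ hiT _ hkT _ (h.mono _ _ (by omega))
      (h.mono _ _ (by omega))
    have q1 : T = S' := by
      by_contra hh
      exact Set.disjoint_left.1 (hP.1.2 hT hS' hh) t1 hm
    have q2 : T = S := by
      by_contra hh
      exact Set.disjoint_left.1 (hP.1.2 hT hS hh) t2 hnS
    exact hSS (q1.symm.trans q2)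
  have hSlow : ∀ i < n, β i ∉ S := fun i hi hiS => absurd (hlow S hS i hi hiS n hnS) (by omega)
  have hSseg := hP.1.1 S hS
  have hSup : ∀ c ∈ S, β n <+: c := by
    intro c hc
    rcases hSseg.1 _ hnS _ hc with hh | hh
    · exact hh
    · obtain ⟨h3, h4⟩ := h.eq_of_prefix hh
      rcases h4.lt_or_eq with h5 | h5
      · exact absurd (h3 ▸ hc) (hSlow _ h5)
      · rw [h3, h5]
  have cmp : ∀ R U, Ach x R U → (U ⊆ β '' Set.Iic n ∪ S) →
      R ≤ ∑ k ∈ Finset.range n, x (β k) ^ 2 + segSum x S ^ 2 := by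
    intro R U hA hU
    refine h.compare hsupp hE hP hS hnS hlow R ?_
    intro c F hFP hF hc
    have hA2 : Ach x c (⋃₀ (F : Set (Set DyadicNode))) :=
      ⟨F, fun T hT => ⟨hP.1.1 T (hFP hT), Set.subset_sUnion_of_mem hT⟩, hP.1.2.subset hFP, hc⟩
    refine (hA.union hA2 ?_).le hx
    refine Set.disjoint_left.2 ?_
    rintro v hv ⟨T, hT, hvT⟩
    rcases hU hv with ⟨k, hk, rfl⟩ | hvS
    · exact (hF T hT).2 k hk hvT
    · exact Set.disjoint_left.1 (hP.1.2 (hFP hT) hS (hF T hT).1) hvT hvS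
  by_cases hsum : Summable (fun v : S => x v)
  swap
  · exfalso
    have z : segSum x S = 0 := tsum_eq_zero_of_not_summable hsum
    have := cmp _ _ (Ach.range h x (n + 1)) (by
      rintro _ ⟨k, hk, rfl⟩
      exact Or.inl ⟨k, Nat.lt_succ_iff.1 hk, rfl⟩)
    rw [Finset.sum_range_succ, z] at this
    have : 0 < x (β n) ^ 2 := by positivity
    linarith
  have hD : ∑ k ∈ Finset.range s, x (β k) ^ 2 + ∑ k ∈ Finset.Ico s n, x (β k) ^ 2
      = ∑ k ∈ Finset.range n, x (β k) ^ 2 := Finset.sum_range_add_sum_Ico _ hs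
  refine alg_key _ _ (segSum x S) _ (hE s n hs le_rfl) ?_ ?_
  · -- the merged segment
    have hseg : IsSegment (β '' Set.Ico s n ∪ S) := by
      constructor
      · rintro u (⟨i, hi, rfl⟩ | hu) v (⟨j, hj, rfl⟩ | hv)
        · exact (h.segment s n).1 _ ⟨i, hi, rfl⟩ _ ⟨j, hj, rfl⟩
        · exact Or.inl ((h.mono _ _ hi.2.le).trans (hSup v hv))
        · exact Or.inr ((h.mono _ _ hj.2.le).trans (hSup u hu))
        · exact hSseg.1 _ hu _ hv
      · rintro u (⟨i, hi, rfl⟩ | hu) v (⟨j, hj, rfl⟩ | hv) c h1 h2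
        · exact Or.inl ((h.segment s n).2 _ ⟨i, hi, rfl⟩ _ ⟨j, hj, rfl⟩ c h1 h2)
        · rcases List.prefix_or_prefix_of_prefix h2 (hSup v hv) with h3 | h3
          · obtain ⟨h4, h5⟩ := h.eq_of_prefix h3
            rcases h5.lt_or_eq with h6 | h6
            · left
              rw [h4] at h1
              exact ⟨c.length, ⟨hi.1.trans (h.le_of_prefix h1), h6⟩, h4.symm⟩
            · right; rw [h4, h6]; exact hnS
          · exact Or.inr (hSseg.2 _ hnS _ hv _ h3 h2)
        · have := h.le_of_prefix ((hSup u hu).trans (h1.trans h2))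
          have := hj.2
          omega
        · exact Or.inr (hSseg.2 _ hu _ hv _ h1 h2)
    have hdis : Disjoint (β '' Set.Ico s n) S := by
      refine Set.disjoint_left.2 ?_
      rintro _ ⟨i, hi, rfl⟩ hiS
      exact hSlow i hi.2 hiS
    have hval : segSum x (β '' Set.Ico s n ∪ S) =
        ∑ k ∈ Finset.Ico s n, x (β k) + segSum x S := by
      rw [← h.segSum_Ico]
      have : Finite (β '' Set.Ico s n) := (Set.finite_Ico s n).image β
      exact Summable.tsum_union_disjoint hdis (Summable.of_finite) hsum
    have := cmp _ _ ((Ach.range h x s).union (Ach.single hseg) (by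
      refine Set.disjoint_left.2 ?_
      rintro _ ⟨i, hi, rfl⟩ (⟨j, hj, hij⟩ | hiS)
      · have := h.inj hij
        have := hj.1
        have : i < s := hi
        omega
      · exact hSlow i (lt_of_lt_of_le hi hs) hiS)) (by
      rintro _ (⟨i, hi, rfl⟩ | ⟨i, hi, rfl⟩ | hv)
      · exact Or.inl ⟨i, (lt_of_lt_of_le hi hs).le, rfl⟩
      · exact Or.inl ⟨i, hi.2.le, rfl⟩
      · exact Or.inr hv)
    rw [hval] at this
    linarith
  · -- move the node at level `n`
    have hseg : IsSegment (S \ {β n}) := by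
      constructor
      · intro u hu v hv
        exact hSseg.1 u hu.1 v hv.1
      · intro u hu v hv c h1 h2
        refine ⟨hSseg.2 u hu.1 v hv.1 c h1 h2, ?_⟩
        rintro rfl
        apply hu.2
        exact h1.eq_of_length (le_antisymm h1.length_le (hSup u hu.1).length_le)
    have hval : segSum x (S \ {β n}) = segSum x S - x (β n) := by
      have hu : S = {β n} ∪ S \ {β n} := by
        rw [Set.union_sdiff_cancel]; simpa using hnS
      have hs2 : Summable (fun v : (S \ {β n} : Set DyadicNode) => x v) :=
        hsum.comp_injective (i := Set.inclusion Set.sdiff_subset)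
          (Set.inclusion_injective Set.sdiff_subset)
      have e : segSum x ({β n} ∪ S \ {β n}) = segSum x {β n} + segSum x (S \ {β n}) :=
        Summable.tsum_union_disjoint Set.disjoint_sdiff_right Summable.of_finite hs2
      rw [← hu, segSum_singleton] at e
      linarith
    have hd1 : Disjoint (β '' Set.Iio s) (β '' Set.Ico s (n + 1)) := by
      refine Set.disjoint_left.2 ?_
      rintro _ ⟨i, hi, rfl⟩ ⟨j, hj, hij⟩
      have := h.inj hij
      have := hj.1
      have : i < s := hi
      omega
    have hd2 : Disjoint (β '' Set.Iio s ∪ β '' Set.Ico s (n + 1)) (S \ {β n}) := by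
      refine Set.disjoint_left.2 ?_
      have : ∀ i ≤ n, β i ∉ S \ {β n} := by
        rintro i hi ⟨h1, h2⟩
        rcases hi.lt_or_eq with h3 | h3
        · exact hSlow i h3 h1
        · exact h2 (by rw [h3]; rfl)
      rintro _ (⟨i, hi, rfl⟩ | ⟨i, hi, rfl⟩)
      · exact this i (lt_of_lt_of_le hi hs).le
      · exact this i (Nat.lt_succ_iff.1 hi.2)
    have := cmp _ _ (((Ach.range h x s).union (Ach.single (h.segment s (n + 1))) hd1).union
      (Ach.single hseg) hd2) (by
      rintro _ ((⟨i, hi, rfl⟩ | ⟨i, hi, rfl⟩) | hv)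
      · exact Or.inl ⟨i, (lt_of_lt_of_le hi hs).le, rfl⟩
      · exact Or.inl ⟨i, Nat.lt_succ_iff.1 hi.2, rfl⟩
      · exact Or.inr hv.1)
    rw [hval, h.segSum_Ico, Finset.sum_Ico_succ_top hs] at this
    linarith

lemma IsPath.intervals {β : ℕ → DyadicNode} (h : IsPath β) {x : DyadicNode → ℝ}
    (hx : HasBddNorm x) (hsupp : Function.support x ⊆ Set.range β) (hsep : Separated x) (n : ℕ) :
    ∀ s t, s ≤ t → t ≤ n →
      (∑ k ∈ Finset.Ico s t, x (β k)) ^ 2 ≤ ∑ k ∈ Finset.Ico s t, x (β k) ^ 2 := by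
  induction n with
  | zero =>
    intro s t h1 h2
    have : t = 0 := by omega
    subst this; simp
  | succ n ih =>
    intro s t h1 h2
    rcases h2.lt_or_eq with h3 | h3
    · exact ih s t h1 (by omega)
    · subst h3
      rcases h1.lt_or_eq with h4 | h4
      · rw [Finset.sum_Ico_succ_top (by omega), Finset.sum_Ico_succ_top (by omega)]
        exact h.step hx hsupp hsep ih (by omega)
      · subst h4; simp

lemma IsPath.upper {β : ℕ → DyadicNode} (h : IsPath β) {x : DyadicNode → ℝ}
    (hx : HasBddNorm x) (hsupp : Function.support x ⊆ Set.range β) (hsep : Separated x) :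
    JTnormSq x ≤ ∑' v, x v ^ 2 := by
  classical
  have hs := (sum_sq_bound hx).1
  have h0 : 0 ≤ ∑' v, x v ^ 2 := tsum_nonneg fun _ => sq_nonneg _
  have hfin : ∀ M, ∑ k ∈ Finset.range M, x (β k) ^ 2 ≤ ∑' v, x v ^ 2 := by
    intro M
    rw [← Finset.sum_image (f := fun v => x v ^ 2) (g := β) (fun a _ b _ hab => h.inj hab)]
    exact hs.sum_le_tsum _ (fun _ _ => sq_nonneg _)
  apply Real.sSup_le _ h0
  rintro r ⟨P, hP, rfl⟩
  refine tsum_le_of_sum_le' h0 ?_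
  intro G0
  have key : ∀ G : Finset (Set DyadicNode), (G : Set (Set DyadicNode)) ⊆ P →
      ∑ T ∈ G, segSum x T ^ 2 ≤ ∑' v, x v ^ 2 := by
    intro G hG
    set G' := G.filter (fun T : Set DyadicNode => Summable (fun v : T => x v)) with hG'
    have e1 : ∑ T ∈ G, segSum x T ^ 2 = ∑ T ∈ G', segSum x T ^ 2 := by
      rw [hG', Finset.sum_filter]
      apply Finset.sum_congr rfl
      intro T _
      split_ifs with hT
      · rfl
      · rw [show segSum x T = 0 from tsum_eq_zero_of_not_summable hT]; simp
    rw [e1]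
    have hG'P : (G' : Set (Set DyadicNode)) ⊆ P := fun T hT => hG (Finset.mem_filter.1 hT).1
    have lim : Filter.Tendsto (fun M => ∑ T ∈ G',
        (∑ k ∈ (Finset.range M).filter (fun k => β k ∈ T), x (β k)) ^ 2) Filter.atTop
        (nhds (∑ T ∈ G', segSum x T ^ 2)) := by
      apply tendsto_finsetSum
      intro T hT
      exact (h.segSum_tendsto hsupp (Finset.mem_filter.1 hT).2).pow 2
    refine le_of_tendsto' lim fun M => ?_
    refine le_trans (Finset.sum_le_sum fun T hT =>
      h.filter_bound (h.intervals hx hsupp hsep M) (hP.1 T (hG'P hT))) ?_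
    exact (IsPath.family_bound G' (hP.2.subset hG'P) x M).trans (hfin M)
  have := key (G0.map (Function.Embedding.subtype _)) (by intro T; simp; tauto)
  simpa using this


/-- If `x ∈ JT` is supported on a single branch and is separated, then
`‖x‖_{JT} = ‖x‖₂`; consequently `x` is an extreme point of the ball of radius `‖x‖_{JT}`. -/
theorem branch_separated (x : DyadicNode → ℝ) (hx : MemJT x)
    (b : Set DyadicNode) (hb : IsBranch b) (hsupp : Function.support x ⊆ b)
    (hsep : Separated x) :
    JTnorm x = l2norm x ∧ (x ≠ 0 → IsExtremePoint x) := by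
  obtain ⟨β, hβ, hbβ⟩ := exists_path b hb.1.1
  have hN : JTnormSq x = ∑' v, x v ^ 2 :=
    le_antisymm (hβ.upper hx.1 (hsupp.trans hbβ) hsep) (sum_sq_bound hx.1).2
  refine ⟨by rw [JTnorm, l2norm, hN], fun hx0 => ⟨hx0, ?_⟩⟩
  intro y z hy hz l hl0 hl1 hxyz hyx hzx
  have hyN : JTnormSq y = JTnormSq x :=
    (Real.sqrt_inj (JTnormSq_nonneg _) (JTnormSq_nonneg _)).1 hyx
  have hzN : JTnormSq z = JTnormSq x :=
    (Real.sqrt_inj (JTnormSq_nonneg _) (JTnormSq_nonneg _)).1 hzx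
  obtain ⟨sy, by1⟩ := sum_sq_bound hy.1
  obtain ⟨sz, bz1⟩ := sum_sq_bound hz.1
  obtain ⟨sx, -⟩ := sum_sq_bound hx.1
  have hpt : ∀ v, x v = l * y v + (1 - l) * z v := by
    intro v; rw [hxyz]; simp
  have hyz : ∀ v, y v = z v := by
    intro v
    have hd : HasSum (fun v => l * y v ^ 2 + (1 - l) * z v ^ 2 - x v ^ 2)
        (l * (∑' v, y v ^ 2) + (1 - l) * (∑' v, z v ^ 2) - ∑' v, x v ^ 2) :=
      ((sy.hasSum.mul_left l).add (sz.hasSum.mul_left (1 - l))).sub sx.hasSum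
    have hdv : ∀ w, l * y w ^ 2 + (1 - l) * z w ^ 2 - x w ^ 2 =
        l * (1 - l) * (y w - z w) ^ 2 := by
      intro w; rw [hpt w]; ring
    have hpos : 0 < l * (1 - l) := mul_pos hl0 (by linarith)
    have hle := le_hasSum hd v (fun w _ => by rw [hdv w]; positivity)
    simp only [hdv] at hle
    have h2 : l * (1 - l) * (y v - z v) ^ 2 ≤ 0 := by
      have e1 : l * (∑' v, y v ^ 2) ≤ l * JTnormSq x :=
        mul_le_mul_of_nonneg_left (by linarith) hl0.le
      have e2 : (1 - l) * (∑' v, z v ^ 2) ≤ (1 - l) * JTnormSq x :=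
        mul_le_mul_of_nonneg_left (by linarith) (by linarith)
      linarith
    have h3 : (y v - z v) ^ 2 ≤ 0 := by
      by_contra hc
      push Not at hc
      have := mul_pos hpos hc
      linarith
    have h4 : y v - z v = 0 := by
      have := sq_nonneg (y v - z v)
      exact pow_eq_zero_iff (two_ne_zero) |>.1 (le_antisymm h3 this)
    linarith
  constructor
  · funext v; rw [hpt v, ← hyz v]; ring
  · funext v; rw [hpt v, hyz v]; ring

end JTSpace
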